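/- Let {σ_n}_{n≥1} ⊂ S(H) be a sequence of states converging in trace norm to a faithful state σ₀ with σ_n ≠ σ₀ for all n. Define the quantum channels on T(H): Φ₀ = id (the identity map) and Φ_n(ρ) = (Tr ρ)·σ_n for n ≥ 1, and let F* = {Φ_n}_{n≥0}. Then: (1) { Φ(σ₀) : Φ ∈ F* } = {σ_n}_{n≥0} is a compact subset of S(H); (2) the sequence {Φ_n}_{n≥1} converges strongly to the channel Φ*(ρ) = (Tr ρ)·σ₀, which does not belong to F*; and (3) consequently F* is not closed and not compact in the strong convergence topology (so the closedness assumption in the compactness criterion for sets of quantum operations cannot be dropped). -/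

import Mathlib

open Filter Topology ContinuousLinearMap
open scoped ComplexOrder

noncomputable section

notation "⟪" x ", " y "⟫" => @inner ℂ _ _ x y

section Defs

variable {H K : Type*} [NormedAddCommGroup H] [InnerProductSpace ℂ H] [CompleteSpace H]
  [NormedAddCommGroup K] [InnerProductSpace ℂ K] [CompleteSpace K]

/-- The rank-one operator `|y⟩⟨z|`. -/
def rankOne (y : K) (z : H) : H →L[ℂ] K :=
  (ContinuousLinearMap.toSpanSingleton ℂ y).comp (innerSL ℂ z)

/-- `A` is a trace-class operator (equivalently, nuclear operator). -/
def IsTC (A : H →L[ℂ] K) : Prop :=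
  ∃ f : ℕ → K, ∃ g : ℕ → H, Summable (fun n => ‖f n‖ * ‖g n‖) ∧
    ∀ x : H, HasSum (fun n => ⟪g n, x⟫ • f n) (A x)

/-- The trace of an operator, computed in a Hilbert basis. -/
def trC {ι : Type*} (e : HilbertBasis ι ℂ H) (A : H →L[ℂ] H) : ℂ :=
  ∑' i, ⟪e i, A (e i)⟫

/-- The trace norm `‖A‖₁ = sup {|Tr (B A)| : ‖B‖ ≤ 1}`. -/
def tnorm {ι : Type*} (e : HilbertBasis ι ℂ H) (A : H →L[ℂ] H) : ℝ :=
  sSup { r : ℝ | ∃ B : H →L[ℂ] H, ‖B‖ ≤ 1 ∧ r = ‖trC e (B ∘L A)‖ }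

/-- Membership in the positive cone `T₊(H)` of trace-class operators. -/
def IsPTC (ρ : H →L[ℂ] H) : Prop := ρ.IsPositive ∧ IsTC ρ

/-- `ρ` is a state (a positive trace-class operator of unit trace). -/
def IsState {ι : Type*} (e : HilbertBasis ι ℂ H) (ρ : H →L[ℂ] H) : Prop :=
  ρ.IsPositive ∧ IsTC ρ ∧ trC e ρ = 1

/-- `ρ` is a faithful state (a state with trivial kernel). -/
def IsFaithfulState {ι : Type*} (e : HilbertBasis ι ℂ H) (ρ : H →L[ℂ] H) : Prop :=
  IsState e ρ ∧ ∀ x, ρ x = 0 → x = 0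

/-- The Loewner operator order. -/
def OpLE (A B : H →L[ℂ] H) : Prop := (B - A).IsPositive

/-- `S` is the least upper bound of the sequence `A` in the Loewner order. -/
def IsLUBOp (A : ℕ → H →L[ℂ] H) (S : H →L[ℂ] H) : Prop :=
  (∀ m, OpLE (A m) S) ∧ ∀ C, (∀ m, OpLE (A m) C) → OpLE S C

/-- A quantum operation from `A` to `B`: a completely positive trace-non-increasing
linear map from `T(H_A)` to `T(H_B)`. -/
structure QOp (eA : HilbertBasis ℕ ℂ H) (eB : HilbertBasis ℕ ℂ K) where
  toFun : (H →L[ℂ] H) → (K →L[ℂ] K)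
  map_add' : ∀ ρ σ : H →L[ℂ] H, IsTC ρ → IsTC σ → toFun (ρ + σ) = toFun ρ + toFun σ
  map_smul' : ∀ (c : ℂ) (ρ : H →L[ℂ] H), IsTC ρ → toFun (c • ρ) = c • toFun ρ
  maps_tc' : ∀ ρ : H →L[ℂ] H, IsTC ρ → IsTC (toFun ρ)
  completely_pos' : ∀ (n : ℕ) (y : Fin n → H) (x : Fin n → K),
    0 ≤ ∑ i, ∑ j, ⟪x i, toFun (rankOne (y i) (y j)) (x j)⟫
  trace_nonincreasing' : ∀ ρ : H →L[ℂ] H, ρ.IsPositive → IsTC ρ →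
    (trC eB (toFun ρ)).re ≤ (trC eA ρ).re

variable {eA : HilbertBasis ℕ ℂ H} {eB : HilbertBasis ℕ ℂ K}

/-- A quantum channel is a trace-preserving quantum operation. -/
def IsChannel (Φ : QOp eA eB) : Prop :=
  ∀ ρ : H →L[ℂ] H, ρ.IsPositive → IsTC ρ → trC eB (Φ.toFun ρ) = trC eA ρ

/-- Convergence in the trace norm. -/
def TNConv {ι : Type*} (e : HilbertBasis ι ℂ K) (a : ℕ → K →L[ℂ] K) (L : K →L[ℂ] K) : Prop :=
  Tendsto (fun n => tnorm e (a n - L)) atTop (nhds 0)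

/-- Strong convergence of a sequence of quantum operations. -/
def StrongConv (Φn : ℕ → QOp eA eB) (Φ : QOp eA eB) : Prop :=
  ∀ ρ : H →L[ℂ] H, IsState eA ρ → TNConv eB (fun n => (Φn n).toFun ρ) (Φ.toFun ρ)

/-- Relative (sequential) compactness in the strong convergence topology. -/
def QRelCompact (F : Set (QOp eA eB)) : Prop :=
  ∀ Φs : ℕ → QOp eA eB, (∀ n, Φs n ∈ F) →
    ∃ (k : ℕ → ℕ) (Φ₀ : QOp eA eB), StrictMono k ∧ StrongConv (fun n => Φs (k n)) Φ₀

/-- Relative (sequential) compactness within the set of quantum channels. -/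
def QRelCompactCh (F : Set (QOp eA eB)) : Prop :=
  ∀ Φs : ℕ → QOp eA eB, (∀ n, Φs n ∈ F) →
    ∃ (k : ℕ → ℕ) (Φ₀ : QOp eA eB), StrictMono k ∧ IsChannel Φ₀ ∧
      StrongConv (fun n => Φs (k n)) Φ₀

/-- (Sequential) compactness in the strong convergence topology. -/
def QSeqCompact (F : Set (QOp eA eB)) : Prop :=
  ∀ Φs : ℕ → QOp eA eB, (∀ n, Φs n ∈ F) →
    ∃ (k : ℕ → ℕ) (Φ₀ : QOp eA eB), StrictMono k ∧ Φ₀ ∈ F ∧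
      StrongConv (fun n => Φs (k n)) Φ₀

/-- (Sequential) closedness in the strong convergence topology. -/
def QSeqClosed (F : Set (QOp eA eB)) : Prop :=
  ∀ (Φs : ℕ → QOp eA eB) (Φ₀ : QOp eA eB), (∀ n, Φs n ∈ F) → StrongConv Φs Φ₀ → Φ₀ ∈ F

/-- (Sequential) compactness of a set of operators in the trace norm. -/
def TNSeqCompact {ι : Type*} (e : HilbertBasis ι ℂ K) (S : Set (K →L[ℂ] K)) : Prop :=
  ∀ a : ℕ → K →L[ℂ] K, (∀ n, a n ∈ S) →
    ∃ (k : ℕ → ℕ) (L : K →L[ℂ] K), StrictMono k ∧ L ∈ S ∧ TNConv e (fun n => a (k n)) L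

/-- Relative (sequential) compactness of `S` within the ambient set `T`, in the trace norm. -/
def TNRelCompactIn {ι : Type*} (e : HilbertBasis ι ℂ K) (T S : Set (K →L[ℂ] K)) : Prop :=
  ∀ a : ℕ → K →L[ℂ] K, (∀ n, a n ∈ S) →
    ∃ (k : ℕ → ℕ) (L : K →L[ℂ] K), StrictMono k ∧ L ∈ T ∧ TNConv e (fun n => a (k n)) L

/-- `A` is a Kraus representation of `Φ`. -/
def KrausRep (Φ : QOp eA eB) (A : ℕ → H →L[ℂ] K) : Prop :=
  ∀ ρ : H →L[ℂ] H, IsTC ρ →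
    HasSum (fun n => A n ∘L ρ ∘L (ContinuousLinearMap.adjoint (A n))) (Φ.toFun ρ)

/-- The Choi rank of a quantum operation: the minimal number of Kraus operators. -/
def ChoiRank (Φ : QOp eA eB) : ℕ∞ :=
  sInf { n : ℕ∞ | ∃ A : ℕ → H →L[ℂ] K, (∀ i : ℕ, n ≤ (i : ℕ∞) → A i = 0) ∧ KrausRep Φ A }

/-- Convergence in the strong operator topology. -/
def SOTConv (a : ℕ → H →L[ℂ] K) (A : H →L[ℂ] K) : Prop :=
  ∀ x : H, Tendsto (fun n => a n x) atTop (nhds (A x))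

/-- Relative (sequential) compactness in the strong operator topology. -/
def SOTRelCompact (S : Set (H →L[ℂ] K)) : Prop :=
  ∀ a : ℕ → H →L[ℂ] K, (∀ n, a n ∈ S) →
    ∃ (k : ℕ → ℕ) (A : H →L[ℂ] K), StrictMono k ∧ SOTConv (fun n => a (k n)) A

/-- (Sequential) compactness in the strong operator topology. -/
def SOTSeqCompact (S : Set (H →L[ℂ] K)) : Prop :=
  ∀ a : ℕ → H →L[ℂ] K, (∀ n, a n ∈ S) →
    ∃ (k : ℕ → ℕ) (A : H →L[ℂ] K), StrictMono k ∧ A ∈ S ∧ SOTConv (fun n => a (k n)) A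

/-- A finite-rank orthogonal projection. -/
def IsFinRankProj (P : K →L[ℂ] K) : Prop :=
  IsSelfAdjoint P ∧ P ∘L P = P ∧ FiniteDimensional ℂ (LinearMap.range (P : K →ₗ[ℂ] K))

end Defs

section Tensor

variable {H K W : Type*} [NormedAddCommGroup H] [InnerProductSpace ℂ H] [CompleteSpace H]
  [NormedAddCommGroup K] [InnerProductSpace ℂ K] [CompleteSpace K]
  [NormedAddCommGroup W] [InnerProductSpace ℂ W] [CompleteSpace W]

/-- A realization of `W` as the Hilbert tensor product `H ⊗ K`. -/
structure TensorStruct (H K W : Type*) [NormedAddCommGroup H] [InnerProductSpace ℂ H]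
    [NormedAddCommGroup K] [InnerProductSpace ℂ K]
    [NormedAddCommGroup W] [InnerProductSpace ℂ W] where
  mul : H → K → W
  inner_mul : ∀ (x x' : H) (y y' : K), ⟪mul x y, mul x' y'⟫ = ⟪x, x'⟫ * ⟪y, y'⟫
  dense_span : Dense (↑(Submodule.span ℂ {w : W | ∃ x y, w = mul x y}) : Set W)

/-- `Z = X ⊗ Y` relative to the tensor realization `T`. -/
def IsTensorOp (T : TensorStruct H K W) (X : H →L[ℂ] H) (Y : K →L[ℂ] K)
    (Z : W →L[ℂ] W) : Prop :=
  ∀ x y, Z (T.mul x y) = T.mul (X x) (Y y)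

/-- `b = Tr_K ω`, the left partial trace, characterized by duality. -/
def IsLeftMarginal (T : TensorStruct H K W) {ι κ : Type*} (eH : HilbertBasis ι ℂ H)
    (eW : HilbertBasis κ ℂ W) (ω : W →L[ℂ] W) (b : H →L[ℂ] H) : Prop :=
  ∀ (X : H →L[ℂ] H) (Z : W →L[ℂ] W), IsTensorOp T X 1 Z →
    trC eH (b ∘L X) = trC eW (ω ∘L Z)

/-- `c = Tr_H ω`, the right partial trace, characterized by duality. -/
def IsRightMarginal (T : TensorStruct H K W) {ι κ : Type*} (eK : HilbertBasis ι ℂ K)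
    (eW : HilbertBasis κ ℂ W) (ω : W →L[ℂ] W) (c : K →L[ℂ] K) : Prop :=
  ∀ (Y : K →L[ℂ] K) (Z : W →L[ℂ] W), IsTensorOp T 1 Y Z →
    trC eK (c ∘L Y) = trC eW (ω ∘L Z)

end Tensor

section Helpers

variable {H : Type*} [NormedAddCommGroup H] [InnerProductSpace ℂ H]

lemma rankOne_apply (y z x : H) : rankOne y z x = ⟪z, x⟫ • y := by
  simp [rankOne]

lemma isTC_rankOne (y z : H) : IsTC (rankOne y z) := by
  refine ⟨fun n => if n = 0 then y else 0, fun n => if n = 0 then z else 0,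
    summable_of_ne_finset_zero (s := {0}) fun n hn => ?_, fun x => ?_⟩
  · simp_all
  · convert hasSum_single (f := fun n : ℕ => ⟪if n = 0 then z else (0 : H), x⟫ •
      (if n = 0 then y else (0 : H))) 0 fun n hn => ?_ using 1
    · simp [rankOne_apply]
    · simp [hn]

lemma trC_rankOne {ι : Type*} (e : HilbertBasis ι ℂ H) (y z : H) :
    trC e (rankOne y z) = ⟪z, y⟫ := by
  simp only [trC, rankOne_apply, inner_smul_right]
  exact e.tsum_inner_mul_inner z y

lemma rankOne_comp [CompleteSpace H] (y z : H) (A : H →L[ℂ] H) :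
    rankOne y z ∘L A = rankOne y (adjoint A z) := by
  ext x
  simp [rankOne_apply, adjoint_inner_left]

lemma norm_rankOne_le (y z : H) : ‖rankOne y z‖ ≤ ‖y‖ * ‖z‖ := by
  refine opNorm_le_bound _ (by positivity) fun x => ?_
  rw [rankOne_apply, norm_smul]
  nlinarith [norm_inner_le_norm (𝕜 := ℂ) z x, norm_nonneg y]

lemma isState_rankOne_self {ι : Type*} (e : HilbertBasis ι ℂ H) {y : H}
    (hy : ‖y‖ = 1) : IsState e (rankOne y y) := by
  refine ⟨?_, isTC_rankOne y y, ?_⟩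
  · rw [isPositive_iff_complex]
    intro x
    have h : ⟪rankOne y y x, x⟫ = ((‖⟪y, x⟫‖ ^ 2 : ℝ) : ℂ) := by
      rw [rankOne_apply, inner_smul_left]
      push_cast
      exact RCLike.conj_mul _
    rw [h]
    exact ⟨by rw [RCLike.re_to_complex, Complex.ofReal_re],
      by rw [RCLike.re_to_complex, Complex.ofReal_re]; positivity⟩
  · rw [trC_rankOne, inner_self_eq_norm_sq_to_K, hy]
    simp

lemma tnorm_nonneg {ι : Type*} (e : HilbertBasis ι ℂ H) (A : H →L[ℂ] H) :
    0 ≤ tnorm e A :=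
  Real.sSup_nonneg (by rintro _ ⟨B, -, rfl⟩; exact norm_nonneg _)

lemma tnorm_zero {ι : Type*} (e : HilbertBasis ι ℂ H) :
    tnorm e (0 : H →L[ℂ] H) = 0 := by
  refine le_antisymm (Real.sSup_nonpos ?_) (tnorm_nonneg e 0)
  rintro _ ⟨B, -, rfl⟩
  simp [trC]

/-- The diagonal of `B ∘L A` is absolutely summable, uniformly over contractions `B`. -/
def HasBoundedDiagonals {ι : Type*} (e : HilbertBasis ι ℂ H)
    (A : H →L[ℂ] H) : Prop :=
  ∃ C : ℝ, ∀ B : H →L[ℂ] H, ‖B‖ ≤ 1 → ∀ s : Finset ι, ∑ i ∈ s, ‖⟪e i, B (A (e i))⟫‖ ≤ C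

lemma HasBoundedDiagonals.sub {ι : Type*} {e : HilbertBasis ι ℂ H}
    {A A' : H →L[ℂ] H} (hA : HasBoundedDiagonals e A) (hA' : HasBoundedDiagonals e A') :
    HasBoundedDiagonals e (A - A') := by
  obtain ⟨C, hC⟩ := hA
  obtain ⟨C', hC'⟩ := hA'
  refine ⟨C + C', fun B hB s => ?_⟩
  refine le_trans ?_ (add_le_add (hC B hB s) (hC' B hB s))
  rw [← Finset.sum_add_distrib]
  refine Finset.sum_le_sum fun i _ => ?_
  simpa [inner_sub_right] using norm_sub_le ⟪e i, B (A (e i))⟫ ⟪e i, B (A' (e i))⟫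

lemma sum_norm_inner_mul_le {ι : Type*} (e : HilbertBasis ι ℂ H) (x y : H)
    (s : Finset ι) : ∑ i ∈ s, ‖⟪x, e i⟫‖ * ‖⟪e i, y⟫‖ ≤ ‖x‖ * ‖y‖ := by
  refine (Real.sum_mul_le_sqrt_mul_sqrt _ _ _).trans ?_
  have hb : ∀ z : H, √(∑ i ∈ s, ‖⟪e i, z⟫‖ ^ 2) ≤ ‖z‖ := fun z =>
    Real.sqrt_le_iff.2 ⟨norm_nonneg z, e.orthonormal.sum_inner_products_le z⟩
  have hx := hb x
  simp only [norm_inner_symm _ x] at hx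
  gcongr
  exact hb y

lemma IsTC.hasBoundedDiagonals {ι : Type*} (e : HilbertBasis ι ℂ H)
    {A : H →L[ℂ] H} (hA : IsTC A) : HasBoundedDiagonals e A := by
  obtain ⟨f, g, hfg, hsum⟩ := hA
  refine ⟨∑' n, ‖f n‖ * ‖g n‖, fun B hB s => ?_⟩
  have hBf : ∀ x, ‖B x‖ ≤ ‖x‖ := fun x => by
    simpa using B.le_of_opNorm_le hB x
  have hbound : ∀ n i, ‖⟪g n, e i⟫‖ * ‖⟪e i, B (f n)⟫‖ ≤ ‖f n‖ * ‖g n‖ := fun n i => by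
    have h := sum_norm_inner_mul_le e (g n) (B (f n)) {i}
    rw [Finset.sum_singleton] at h
    nlinarith [hBf (f n), norm_nonneg (g n)]
  have hS : ∀ i, Summable fun n => ‖⟪g n, e i⟫‖ * ‖⟪e i, B (f n)⟫‖ := fun i =>
    Summable.of_nonneg_of_le (fun n => by positivity) (fun n => hbound n i) hfg
  have hterm : ∀ i, ‖⟪e i, B (A (e i))⟫‖ ≤ ∑' n, ‖⟪g n, e i⟫‖ * ‖⟪e i, B (f n)⟫‖ := by
    intro i
    have h : HasSum (fun n => ⟪g n, e i⟫ * ⟪e i, B (f n)⟫) ⟪e i, B (A (e i))⟫ := by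
      simpa [inner_smul_right] using (innerSL ℂ (e i)).hasSum (B.hasSum (hsum (e i)))
    rw [← h.tsum_eq]
    simpa using norm_tsum_le_tsum_norm (f := fun n => ⟪g n, e i⟫ * ⟪e i, B (f n)⟫)
      (by simpa using hS i)
  calc ∑ i ∈ s, ‖⟪e i, B (A (e i))⟫‖
      ≤ ∑ i ∈ s, ∑' n, ‖⟪g n, e i⟫‖ * ‖⟪e i, B (f n)⟫‖ := Finset.sum_le_sum fun i _ => hterm i
    _ = ∑' n, ∑ i ∈ s, ‖⟪g n, e i⟫‖ * ‖⟪e i, B (f n)⟫‖ :=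
      (Summable.tsum_finsetSum fun i _ => hS i).symm
    _ ≤ ∑' n, ‖f n‖ * ‖g n‖ := by
      refine Summable.tsum_le_tsum (fun n => ?_) (summable_sum fun i _ => hS i) hfg
      refine (sum_norm_inner_mul_le e (g n) (B (f n)) s).trans ?_
      nlinarith [hBf (f n), norm_nonneg (g n)]

lemma HasBoundedDiagonals.norm_inner_le_tnorm [CompleteSpace H] {ι : Type*}
    {e : HilbertBasis ι ℂ H} {A : H →L[ℂ] H} (hA : HasBoundedDiagonals e A) (i j : ι) :
    ‖⟪e i, A (e j)⟫‖ ≤ tnorm e A := by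
  obtain ⟨C, hC⟩ := hA
  refine le_csSup ⟨C, ?_⟩ ⟨rankOne (e j) (e i), ?_, ?_⟩
  · rintro _ ⟨B, hB, rfl⟩
    have hs : Summable fun i => ‖⟪e i, B (A (e i))⟫‖ :=
      summable_of_sum_le (fun _ => norm_nonneg _) (hC B hB)
    exact (norm_tsum_le_tsum_norm hs).trans (hs.tsum_le_of_sum_le (hC B hB))
  · simpa [e.orthonormal.1] using norm_rankOne_le (e j) (e i)
  · rw [rankOne_comp, trC_rankOne, adjoint_inner_left]

lemma TNConv.eq_of_isTC [CompleteSpace H] {ι : Type*} {e : HilbertBasis ι ℂ H}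
    {a : ℕ → H →L[ℂ] H} {L L' : H →L[ℂ] H} (ha : ∀ n, IsTC (a n)) (hL : IsTC L) (hL' : IsTC L')
    (h : TNConv e a L) (h' : TNConv e a L') : L = L' := by
  have key : ∀ M, IsTC M → TNConv e a M → ∀ i j,
      Tendsto (fun n => ⟪e i, a n (e j)⟫) atTop (𝓝 ⟪e i, M (e j)⟫) := by
    intro M hM hconv i j
    rw [tendsto_iff_norm_sub_tendsto_zero]
    refine squeeze_zero (fun _ => norm_nonneg _) (fun n => ?_) hconv
    simpa [inner_sub_right] using
      (((ha n).hasBoundedDiagonals e).sub (hM.hasBoundedDiagonals e)).norm_inner_le_tnorm i j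
  refine ContinuousLinearMap.ext_on
    ((Submodule.dense_iff_topologicalClosure_eq_top).2 e.dense_span) ?_
  rintro _ ⟨j, rfl⟩
  refine e.repr.injective (lp.ext (funext fun i => ?_))
  simp only [e.repr_apply_apply]
  exact tendsto_nhds_unique (key L hL h i j) (key L' hL' h' i j)

lemma tnSeqCompact_of_tnConv {ι : Type*} {e : HilbertBasis ι ℂ H}
    {σ : ℕ → H →L[ℂ] H} {L : H →L[ℂ] H} (h : TNConv e σ L) :
    TNSeqCompact e {x | x = L ∨ ∃ k, x = σ k} := by
  intro a ha
  by_cases hsub : ∀ ε > 0, ∃ᶠ n in atTop, tnorm e (a n - L) < ε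
  · obtain ⟨k, hk, hlt⟩ := extraction_forall_of_frequently
      (P := fun m n => tnorm e (a n - L) < 1 / ((m : ℝ) + 1))
      fun m => hsub (1 / ((m : ℝ) + 1)) (by positivity)
    exact ⟨k, L, hk, Or.inl rfl, squeeze_zero (fun _ => tnorm_nonneg _ _)
      (fun m => (hlt m).le) tendsto_one_div_add_atTop_nhds_zero_nat⟩
  · push Not at hsub
    obtain ⟨ε, hε, hev⟩ := hsub
    obtain ⟨N, hN⟩ := eventually_atTop.1 (h.eventually (gt_mem_nhds hε))
    have hmem : ∃ᶠ n in atTop, ∃ j ∈ Finset.range N, a n = σ j := by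
      refine Eventually.frequently (hev.mono fun n hn => ?_)
      rcases ha n with h0 | ⟨j, hj⟩
      · rw [h0, sub_self, tnorm_zero] at hn
        exact absurd hn (not_le.2 hε)
      · refine ⟨j, Finset.mem_range.2 (not_le.1 fun hle => ?_), hj⟩
        rw [hj] at hn
        exact absurd (hN j hle) (not_lt.2 hn)
    have hconst : ∃ j, ∃ᶠ n in atTop, a n = σ j := by
      by_contra! hno
      refine hmem ?_
      have := (Filter.eventually_all_finset (Finset.range N)).2 fun j _ => hno j
      filter_upwards [this] with n hn
      rintro ⟨j, hj, hjn⟩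
      exact hn j hj hjn
    obtain ⟨j, hj⟩ := hconst
    obtain ⟨k, hk, hkj⟩ := extraction_of_frequently_atTop hj
    refine ⟨k, σ j, hk, Or.inr ⟨j, rfl⟩, ?_⟩
    simp [TNConv, hkj, tnorm_zero]

end Helpers

section Statement

variable {H : Type*} [NormedAddCommGroup H] [InnerProductSpace ℂ H] [CompleteSpace H]

/-- The example showing that the closedness assumption in the compactness criterion cannot be
dropped: for states `σ_n → σ₀` (σ₀ faithful, σ_n ≠ σ₀) and the channels `Φ₀ = id`,
`Φ_n(ρ) = (Tr ρ)·σ_n`, the family `F* = {Φ_n}_{n≥0}` has a compact image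
`{Φ(σ₀) : Φ ∈ F*} = {σ_n}_{n≥0}`, while `{Φ_n}_{n≥1}` converges strongly to the channel
`Φ*(ρ) = (Tr ρ)·σ₀ ∉ F*`; hence `F*` is neither closed nor compact in the strong convergence
topology. -/
theorem noncompact_family_with_compact_image
    (e : HilbertBasis ℕ ℂ H)
    (σ₀ : H →L[ℂ] H) (hσ₀ : IsFaithfulState e σ₀)
    (σn : ℕ → H →L[ℂ] H) (hσn : ∀ k, IsState e (σn k))
    (hne : ∀ k, σn k ≠ σ₀)
    (hσconv : TNConv e σn σ₀)
    (Φ₀ : QOp e e) (hΦ₀ch : IsChannel Φ₀) (hΦ₀ : ∀ ρ : H →L[ℂ] H, Φ₀.toFun ρ = ρ)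
    (Φ : ℕ → QOp e e) (hΦch : ∀ k, IsChannel (Φ k))
    (hΦ : ∀ (k : ℕ) (ρ : H →L[ℂ] H), IsTC ρ → (Φ k).toFun ρ = trC e ρ • σn k)
    (Φs : QOp e e) (hΦsch : IsChannel Φs)
    (hΦs : ∀ ρ : H →L[ℂ] H, IsTC ρ → Φs.toFun ρ = trC e ρ • σ₀) :
    ({x | ∃ Ψ ∈ ({Ψ | Ψ = Φ₀ ∨ ∃ k, Ψ = Φ k} : Set (QOp e e)), x = Ψ.toFun σ₀}
        = {x | x = σ₀ ∨ ∃ k, x = σn k} ∧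
      TNSeqCompact e {x | x = σ₀ ∨ ∃ k, x = σn k}) ∧
    (StrongConv Φ Φs ∧
      ∀ Ψ ∈ ({Ψ | Ψ = Φ₀ ∨ ∃ k, Ψ = Φ k} : Set (QOp e e)), Φs.toFun ≠ Ψ.toFun) ∧
    (¬ QSeqClosed ({Ψ | Ψ = Φ₀ ∨ ∃ k, Ψ = Φ k} : Set (QOp e e)) ∧
      ¬ QSeqCompact ({Ψ | Ψ = Φ₀ ∨ ∃ k, Ψ = Φ k} : Set (QOp e e))) := by
  have hσ₀TC : IsTC σ₀ := hσ₀.1.2.1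
  have hΦσ₀ : ∀ k, (Φ k).toFun σ₀ = σn k := fun k => by
    rw [hΦ k σ₀ hσ₀TC, hσ₀.1.2.2, one_smul]
  have hstrong : StrongConv Φ Φs := fun ρ hρ => by
    simpa only [hΦ _ ρ hρ.2.1, hΦs ρ hρ.2.1, hρ.2.2, one_smul] using hσconv
  have he : ∀ i, ‖e i‖ = 1 := e.orthonormal.1
  have he₁₀ : ⟪e 1, e 0⟫ = 0 := e.orthonormal.2 one_ne_zero
  have hnot : ∀ Ψ ∈ ({Ψ | Ψ = Φ₀ ∨ ∃ k, Ψ = Φ k} : Set (QOp e e)), Φs.toFun ≠ Ψ.toFun := by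
    rintro Ψ (rfl | ⟨k, rfl⟩) heq
    · have h := hΦs _ (isTC_rankOne (e 0) (e 1))
      rw [heq, hΦ₀, trC_rankOne, he₁₀, zero_smul] at h
      have h1 := congrArg (fun T : H →L[ℂ] H => ‖T (e 1)‖) h
      simp [rankOne_apply, he] at h1
    · have h := hΦσ₀ k
      rw [← heq, hΦs _ hσ₀TC, hσ₀.1.2.2, one_smul] at h
      exact hne k h.symm
  refine ⟨⟨?_, tnSeqCompact_of_tnConv hσconv⟩, ⟨hstrong, hnot⟩, fun hcl => ?_, fun hcpt => ?_⟩
  · ext x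
    constructor
    · rintro ⟨Ψ, rfl | ⟨k, rfl⟩, rfl⟩
      · exact Or.inl (hΦ₀ _)
      · exact Or.inr ⟨k, hΦσ₀ k⟩
    · rintro (rfl | ⟨k, rfl⟩)
      · exact ⟨Φ₀, Or.inl rfl, (hΦ₀ _).symm⟩
      · exact ⟨Φ k, Or.inr ⟨k, rfl⟩, (hΦσ₀ k).symm⟩
  · exact hnot Φs (hcl Φ Φs (fun k => Or.inr ⟨k, rfl⟩) hstrong) rfl
  · obtain ⟨k, Ψ, hk, hΨ, hconv⟩ := hcpt Φ fun k => Or.inr ⟨k, rfl⟩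
    have hlim : ∀ ρ, IsState e ρ → Ψ.toFun ρ = σ₀ := fun ρ hρ => by
      have h := hconv ρ hρ
      simp only [hΦ _ ρ hρ.2.1, hρ.2.2, one_smul] at h
      exact TNConv.eq_of_isTC (fun n => (hσn (k n)).2.1) (Ψ.maps_tc' ρ hρ.2.1) hσ₀TC h
        (hσconv.comp hk.tendsto_atTop)
    rcases hΨ with rfl | ⟨j, rfl⟩
    · have h := hlim _ (isState_rankOne_self e (he 1))
      rw [hΦ₀] at h
      have h0 : e 0 = 0 := hσ₀.2 (e 0) (by rw [← h, rankOne_apply, he₁₀, zero_smul])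
      simpa [h0] using he 0
    · exact hne j ((hΦσ₀ j).symm.trans (hlim σ₀ hσ₀.1))

end Statement
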